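/- Let $m \geq 1$, $\beta > 0$, $\lambda_2 > 2$ with $0 < \beta \leq m(\lambda_2-2)/2$. Let $J_1, J_2$ be cubes in $\mathbb{R}^m$ and $(x_2, t_2) \in W_{J_2} = J_2 \times (\ell(J_2)/2, \ell(J_2))$. Then $\int_{\mathbb{R}^m} \bigg(\int_{J_1} \frac{\ell(J_1)^\beta \, dz_2}{(t_2 + |x_2 - y_2 - z_2|)^{m+\beta}} \bigg)^2 \Big(\frac{t_2}{t_2 + |y_2|}\Big)^{m \lambda_2} \frac{dy_2}{t_2^m} \lesssim \bigg( \frac{\ell(J_1)^\beta \, |J_1|}{(\ell(J_2) + d(J_1,J_2))^{m + \beta}}\bigg)^2$, with implied constant depending only on $m$, $\beta$, $\lambda_2$. -/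

import Mathlib

open MeasureTheory Set
open scoped ENNReal

noncomputable section

structure Cube (n : ℕ) where
  corner : Fin n → ℝ
  side : ℝ
  side_pos : 0 < side

namespace Cube

variable {n : ℕ}

/-- the cube as a subset of `ℝⁿ` (with the sup metric) -/
def toSet (I : Cube n) : Set (Fin n → ℝ) :=
  {x | ∀ i, I.corner i ≤ x i ∧ x i < I.corner i + I.side}

/-- Lebesgue measure of the cube -/
def vol (I : Cube n) : ℝ := I.side ^ n

def center (I : Cube n) : Fin n → ℝ := fun i => I.corner i + I.side / 2

/-- dyadic child of a cube, indexed by `ε : Fin n → Bool` -/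
def child (I : Cube n) (ε : Fin n → Bool) : Cube n :=
  ⟨fun i => I.corner i + (if ε i then I.side / 2 else 0), I.side / 2, by
    have := I.side_pos; linarith⟩

/-- the concentric cube of twice the side length -/
def double (I : Cube n) : Cube n :=
  ⟨fun i => I.corner i - I.side / 2, 2 * I.side, by have := I.side_pos; linarith⟩

end Cube

/-- distance between two sets in a metric space -/
def setDist' {X : Type*} [MetricSpace X] (A B : Set X) : ℝ :=
  sInf (Set.image2 dist A B)

/-- distance between two cubes (in the sup metric) -/
def cubeDist {n : ℕ} (I J : Cube n) : ℝ := setDist' I.toSet J.toSet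

/-- the long distance `D(I,J) = ℓ(I) + ℓ(J) + d(I,J)` -/
def longDist {n : ℕ} (I J : Cube n) : ℝ := I.side + J.side + cubeDist I J

/-- the dyadic cube of generation `p.1` and position `p.2` in the standard dyadic grid -/
def dyadicCube (n : ℕ) (p : ℤ × (Fin n → ℤ)) : Cube n :=
  ⟨fun i => (p.2 i : ℝ) * (2 : ℝ) ^ (-p.1), (2 : ℝ) ^ (-p.1), by positivity⟩

/-- index of the `k`-generation dyadic ancestor -/
def ancestor (n : ℕ) (k : ℕ) (p : ℤ × (Fin n → ℤ)) : ℤ × (Fin n → ℤ) :=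
  (p.1 - k, fun i => Int.fdiv (p.2 i) (2 ^ k))

/-- goodness of a dyadic cube with parameters `r`, `γ` : for every dyadic cube at least
`2^r` times bigger, the distance to its boundary exceeds `ℓ(I)^γ ℓ(J)^(1-γ)` -/
def isGood (n : ℕ) (r : ℕ) (γ : ℝ) (p : ℤ × (Fin n → ℤ)) : Prop :=
  ∀ q : ℤ × (Fin n → ℤ), 2 ^ r * (dyadicCube n p).side ≤ (dyadicCube n q).side →
    (dyadicCube n p).side ^ γ * (dyadicCube n q).side ^ (1 - γ)
      < setDist' (dyadicCube n p).toSet (frontier (dyadicCube n q).toSet)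

namespace Cube

variable {n : ℕ}

lemma toSet_eq_pi (I : Cube n) :
    I.toSet = Set.pi univ fun i => Ico (I.corner i) (I.corner i + I.side) := by
  ext x
  simp [toSet]

lemma measurableSet_toSet (I : Cube n) : MeasurableSet I.toSet := by
  rw [toSet_eq_pi]
  exact MeasurableSet.univ_pi fun _ => measurableSet_Ico

lemma volume_toSet (I : Cube n) : volume I.toSet = ENNReal.ofReal I.vol := by
  rw [toSet_eq_pi, Real.volume_pi_Ico]
  simp [vol, ENNReal.ofReal_pow I.side_pos.le]

lemma vol_pos (I : Cube n) : 0 < I.vol := pow_pos I.side_pos n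

end Cube

lemma cubeDist_nonneg {n : ℕ} (I J : Cube n) : 0 ≤ cubeDist I J := by
  apply Real.sInf_nonneg
  rintro _ ⟨x, -, y, -, rfl⟩
  exact dist_nonneg

lemma cubeDist_le_dist {n : ℕ} {I J : Cube n} {x y : Fin n → ℝ} (hx : x ∈ I.toSet)
    (hy : y ∈ J.toSet) : cubeDist I J ≤ dist x y := by
  apply csInf_le
  · refine ⟨0, ?_⟩
    rintro _ ⟨x, -, y, -, rfl⟩
    exact dist_nonneg
  · exact ⟨x, hx, y, hy, rfl⟩

/-- Cauchy-Schwarz against the constant function `1`. -/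
lemma sq_integral_le_measureReal_mul_integral_sq {α : Type*} [MeasurableSpace α] {μ : Measure α}
    [IsFiniteMeasure μ] {g : α → ℝ} (hg : Integrable g μ) (hg2 : Integrable (fun x => g x ^ 2) μ) :
    (∫ x, g x ∂μ) ^ 2 ≤ μ.real univ * ∫ x, g x ^ 2 ∂μ := by
  rcases eq_zero_or_neZero μ with rfl | hμ
  · simp
  have hV : 0 < μ.real univ := measureReal_univ_pos
  set V := μ.real univ
  set A := ∫ x, g x ∂μ
  have h0 : 0 ≤ ∫ x, (V * g x - A) ^ 2 ∂μ := integral_nonneg fun x => sq_nonneg _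
  have h1 : ∫ x, (V * g x - A) ^ 2 ∂μ = V ^ 2 * ∫ x, g x ^ 2 ∂μ - 2 * V * A * A + A ^ 2 * V := by
    have : ∀ x, (V * g x - A) ^ 2 = V ^ 2 * g x ^ 2 - 2 * V * A * g x + A ^ 2 := fun x => by ring
    simp_rw [this]
    have hi : Integrable (fun x => V ^ 2 * g x ^ 2 - 2 * V * A * g x) μ :=
      (hg2.const_mul _).sub (hg.const_mul _)
    rw [integral_add hi (integrable_const _),
      integral_sub (hg2.const_mul _) (hg.const_mul _), integral_const_mul, integral_const_mul,
      integral_const, smul_eq_mul]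
    ring
  have h2 : 0 ≤ V * (V * (∫ x, g x ^ 2 ∂μ) - A ^ 2) := by
    rw [h1] at h0
    linarith
  linarith [nonneg_of_mul_nonneg_right h2 hV]

section Fubini

variable {E : Type*} [NormedAddCommGroup E] [MeasurableSpace E] [BorelSpace E]
  [SecondCountableTopology E] {μ ν : Measure E} [SFinite μ] [μ.IsAddLeftInvariant]
  [μ.IsNegInvariant] [IsFiniteMeasure ν] {φ : E → ℝ}

lemma integrable_prod_add_comp_sub_sub (hφ : Integrable φ μ) (hc : Continuous φ) (x : E) :
    Integrable (fun p : E × E => φ p.1 + φ (x - p.1 - p.2)) (μ.prod ν) := by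
  refine (hφ.comp_fst ν).add ?_
  rw [integrable_prod_iff' (by fun_prop : Continuous _).aestronglyMeasurable]
  simp only [sub_right_comm x _ _]
  refine ⟨.of_forall fun z => hφ.comp_sub_left (x - z), ?_⟩
  simp only [integral_sub_left_eq_self (fun y => ‖φ y‖) μ]
  exact integrable_const _

lemma integral_integral_add_comp_sub_sub (hφ : Integrable φ μ) (hc : Continuous φ) (x : E) :
    ∫ y, ∫ z, (φ y + φ (x - y - z)) ∂ν ∂μ = 2 * ν.real univ * ∫ y, φ y ∂μ := by
  rw [integral_integral_swap (f := fun y z => φ y + φ (x - y - z))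
    (integrable_prod_add_comp_sub_sub hφ hc x)]
  simp only [sub_right_comm x _ _]
  have : ∀ z, ∫ y, (φ y + φ (x - z - y)) ∂μ = 2 * ∫ y, φ y ∂μ := fun z => by
    rw [integral_add hφ (hφ.comp_sub_left _), integral_sub_left_eq_self φ μ]
    ring
  simp only [this, integral_const, smul_eq_mul]
  ring

end Fubini

section Bump

variable {E : Type*} [NormedAddCommGroup E]

lemma continuous_div_add_norm_rpow {t : ℝ} (ht : 0 < t) (b : ℝ) :
    Continuous fun y : E => (t / (t + ‖y‖)) ^ b := by
  have h : ∀ y : E, 0 < t + ‖y‖ := fun y => by positivity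
  refine Continuous.rpow_const ?_ fun y => Or.inl (div_pos ht (h y)).ne'
  exact continuous_const.div (by fun_prop) fun y => (h y).ne'

variable [NormedSpace ℝ E]

lemma div_add_norm_rpow_eq {t : ℝ} (ht : 0 < t) (b : ℝ) (y : E) :
    (t / (t + ‖y‖)) ^ b = (1 + ‖t⁻¹ • y‖) ^ (-b) := by
  rw [norm_smul, norm_inv, Real.norm_of_nonneg ht.le, Real.rpow_neg (by positivity),
    ← Real.inv_rpow (by positivity)]
  congr 1
  field_simp

variable [FiniteDimensional ℝ E] [MeasurableSpace E] [BorelSpace E] (μ : Measure E)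
  [μ.IsAddHaarMeasure]

lemma integrable_div_add_norm_rpow {t b : ℝ} (ht : 0 < t) (hb : Module.finrank ℝ E < b) :
    Integrable (fun y : E => (t / (t + ‖y‖)) ^ b) μ := by
  simp_rw [div_add_norm_rpow_eq ht]
  exact (integrable_one_add_norm hb).comp_smul (inv_ne_zero ht.ne')

lemma integral_div_add_norm_rpow {t : ℝ} (ht : 0 < t) (b : ℝ) :
    ∫ y : E, (t / (t + ‖y‖)) ^ b ∂μ
      = t ^ Module.finrank ℝ E * ∫ y : E, (1 + ‖y‖) ^ (-b) ∂μ := by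
  simp_rw [div_add_norm_rpow_eq ht]
  rw [Measure.integral_comp_smul μ (fun y : E => (1 + ‖y‖) ^ (-b)), inv_pow, inv_inv,
    abs_of_pos (by positivity), smul_eq_mul]

end Bump

lemma div_mul_rpow_le {t u v s b : ℝ} (ht : 0 < t) (hu : 0 < u) (hv : 0 < v) (hs : 0 < s)
    (hsuv : s ≤ u + v) (hb : 0 ≤ b) :
    (t / (u * v)) ^ b ≤ (2 / s) ^ b * ((t / u) ^ b + (t / v) ^ b) := by
  wlog huv : u ≤ v generalizing u v
  · rw [mul_comm u v, add_comm]
    exact this hv hu (by linarith) (le_of_not_ge huv)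
  calc (t / (u * v)) ^ b ≤ (2 / s * (t / u)) ^ b := by
        gcongr
        rw [div_mul_div_comm, div_le_div_iff₀ (by positivity) (by positivity)]
        nlinarith [mul_pos ht hu]
    _ = (2 / s) ^ b * (t / u) ^ b := Real.mul_rpow (by positivity) (by positivity)
    _ ≤ _ := by
        gcongr
        have : 0 ≤ (t / v) ^ b := by positivity
        linarith

/-- Splitting the product of a kernel and a weight into a sum of two integrable bumps. -/
lemma kernel_sq_mul_weight_le {t u v s a c : ℝ} (ht : 0 < t) (hu : 0 < u) (hv : t ≤ v)
    (hs : 0 < s) (hsuv : s ≤ u + v) (ha : 0 ≤ a) (hc : 2 * a ≤ c) :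
    ((u ^ a)⁻¹) ^ 2 * (t / v) ^ c
      ≤ (2 / s) ^ (2 * a) * ((t / v) ^ (2 * a) + (t / u) ^ (2 * a)) := by
  have hv0 : 0 < v := ht.trans_le hv
  calc ((u ^ a)⁻¹) ^ 2 * (t / v) ^ c ≤ ((u ^ a)⁻¹) ^ 2 * (t / v) ^ (2 * a) := by
        gcongr ?_ * ?_
        exact Real.rpow_le_rpow_of_exponent_ge (by positivity) ((div_le_one hv0).2 hv) hc
    _ = (t / (u * v)) ^ (2 * a) := by
        rw [← Real.inv_rpow hu.le, ← Real.rpow_natCast, ← Real.rpow_mul (by positivity),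
          Nat.cast_ofNat, mul_comm a 2, ← Real.mul_rpow (by positivity) (by positivity)]
        congr 1
        field_simp
    _ ≤ _ := by
        rw [add_comm]
        exact div_mul_rpow_le ht hu hv0 hs hsuv (by linarith)

/-- the weighted square-integral off-diagonal kernel estimate in `ℝ^m`. -/
theorem stmt_9 (m : ℕ) (hm : 1 ≤ m) (β lam₂ : ℝ) (hβ : 0 < β) (hlam : 2 < lam₂)
    (hβm : β ≤ m * (lam₂ - 2) / 2) :
    ∃ C > 0, ∀ (J₁ J₂ : Cube m) (x₂ : Fin m → ℝ) (t₂ : ℝ),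
      x₂ ∈ J₂.toSet → t₂ ∈ Set.Ioo (J₂.side / 2) J₂.side →
      (∫ y₂, (∫ z₂ in J₁.toSet,
            J₁.side ^ β * ((t₂ + ‖x₂ - y₂ - z₂‖) ^ ((m : ℝ) + β))⁻¹) ^ 2
          * (t₂ / (t₂ + ‖y₂‖)) ^ ((m : ℝ) * lam₂) / t₂ ^ (m : ℝ))
        ≤ C * (J₁.side ^ β * J₁.vol / (J₂.side + cubeDist J₁ J₂) ^ ((m : ℝ) + β)) ^ 2 := by
  set a : ℝ := (m : ℝ) + β with ha
  have ha0 : 0 < a := by positivity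
  have hac : 2 * a ≤ (m : ℝ) * lam₂ := by linarith
  have hfr : (Module.finrank ℝ (Fin m → ℝ) : ℝ) < 2 * a := by
    rw [Module.finrank_fin_fun]
    linarith [Nat.cast_nonneg (α := ℝ) m]
  set K : ℝ := ∫ y : Fin m → ℝ, (1 + ‖y‖) ^ (-(2 * a))
  have hK0 : 0 ≤ K := integral_nonneg fun y => by positivity
  refine ⟨4 ^ (2 * a) * (2 * K) + 1, by positivity, ?_⟩
  intro J₁ J₂ x t hx ht
  have ht0 : 0 < t := (half_pos J₂.side_pos).trans ht.1
  set L : ℝ := J₂.side + cubeDist J₁ J₂ with hL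
  have hd := cubeDist_nonneg J₁ J₂
  have hL0 : 0 < L := add_pos_of_pos_of_nonneg J₂.side_pos hd
  set V : ℝ := J₁.vol with hV
  have hV0 : 0 < V := J₁.vol_pos
  set B : ℝ := J₁.side ^ β
  have hB0 : 0 < B := Real.rpow_pos_of_pos J₁.side_pos β
  set ν : Measure (Fin m → ℝ) := volume.restrict J₁.toSet with hν
  have : IsFiniteMeasure ν := ⟨by simp [hν, Cube.volume_toSet]⟩
  have hνV : ν.real univ = V := by
    simp [hν, measureReal_def, Cube.volume_toSet, hV, J₁.vol_pos.le]
  set φ : (Fin m → ℝ) → ℝ := fun y => (t / (t + ‖y‖)) ^ (2 * a)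
  have hφc : Continuous φ := continuous_div_add_norm_rpow ht0 _
  have hφi : Integrable φ := integrable_div_add_norm_rpow volume ht0 hfr
  have hφI : ∫ y, φ y = t ^ m * K := by
    rw [integral_div_add_norm_rpow volume ht0, Module.finrank_fin_fun]
  have hφ1 : ∀ y, ‖φ y‖ ≤ 1 := fun y => by
    rw [Real.norm_of_nonneg (by positivity)]
    exact Real.rpow_le_one (by positivity)
      ((div_le_one (by positivity)).2 (le_add_of_nonneg_right (norm_nonneg y))) (by positivity)
  have hφν : ∀ y, Integrable (fun z => φ y + φ (x - y - z)) ν := fun y =>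
    (integrable_const _).add (.of_bound (by fun_prop : Continuous _).aestronglyMeasurable 1
      (.of_forall fun z => hφ1 _))
  have hu : ∀ w : Fin m → ℝ, 0 < t + ‖w‖ := fun w => by positivity
  set k : (Fin m → ℝ) → ℝ := fun w => ((t + ‖w‖) ^ a)⁻¹ with hk
  have hkc : Continuous k :=
    Continuous.inv₀ (Continuous.rpow_const (by fun_prop) fun w => Or.inl (hu w).ne')
      fun w => (Real.rpow_pos_of_pos (hu w) a).ne'
  have hk0 : ∀ w, 0 ≤ k w := fun w => by positivity
  have hkb : ∀ w, k w ≤ (t ^ a)⁻¹ := fun w => by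
    simp only [hk]
    gcongr
    exact le_add_of_nonneg_right (norm_nonneg w)
  have hkν : ∀ y, Integrable (fun z => k (x - y - z)) ν := fun y =>
    .of_bound (by fun_prop : Continuous _).aestronglyMeasurable (t ^ a)⁻¹
      (.of_forall fun z => by rw [Real.norm_of_nonneg (hk0 _)]; exact hkb _)
  have hk2ν : ∀ y, Integrable (fun z => k (x - y - z) ^ 2) ν := fun y =>
    .of_bound (by fun_prop : Continuous _).aestronglyMeasurable ((t ^ a)⁻¹ ^ 2)
      (.of_forall fun z => by
        rw [Real.norm_of_nonneg (by positivity)]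
        exact pow_le_pow_left₀ (hk0 _) (hkb _) 2)
  set S : ℝ := (4 / L) ^ (2 * a) with hS
  have hker : ∀ y, ∀ z ∈ J₁.toSet, k (x - y - z) ^ 2 * (t / (t + ‖y‖)) ^ ((m : ℝ) * lam₂)
      ≤ S * (φ y + φ (x - y - z)) := fun y z hz => by
    have hdist : cubeDist J₁ J₂ ≤ ‖x - z‖ := by
      rw [← dist_eq_norm, dist_comm]
      exact cubeDist_le_dist hz hx
    have hnorm : ‖x - z‖ ≤ ‖x - y - z‖ + ‖y‖ := by
      rw [show x - z = (x - y - z) + y by abel]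
      exact norm_add_le _ _
    have h := kernel_sq_mul_weight_le (s := L / 2) ht0 (hu (x - y - z))
      (le_add_of_nonneg_right (norm_nonneg y)) (by positivity)
      (by linarith [ht.1]) ha0.le hac
    rwa [show 2 / (L / 2) = 4 / L by field_simp; norm_num] at h
  have hpt : ∀ y, (∫ z in J₁.toSet, B * k (x - y - z)) ^ 2
      * (t / (t + ‖y‖)) ^ ((m : ℝ) * lam₂) / t ^ (m : ℝ)
      ≤ B ^ 2 * V * S / t ^ m * ∫ z, (φ y + φ (x - y - z)) ∂ν := fun y => by
    rw [Real.rpow_natCast, integral_const_mul, mul_pow]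
    calc _ ≤ B ^ 2 * (V * ∫ z, k (x - y - z) ^ 2 ∂ν)
          * (t / (t + ‖y‖)) ^ ((m : ℝ) * lam₂) / t ^ m := by
          gcongr
          rw [← hνV]
          exact sq_integral_le_measureReal_mul_integral_sq (hkν y) (hk2ν y)
      _ = B ^ 2 * V / t ^ m
          * ∫ z, k (x - y - z) ^ 2 * (t / (t + ‖y‖)) ^ ((m : ℝ) * lam₂) ∂ν := by
          rw [integral_mul_const]
          ring
      _ ≤ B ^ 2 * V / t ^ m * ∫ z, S * (φ y + φ (x - y - z)) ∂ν := by
          gcongr ?_ * ?_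
          exact setIntegral_mono_on ((hk2ν y).mul_const _) ((hφν y).const_mul _)
            J₁.measurableSet_toSet (hker y)
      _ = _ := by
          rw [integral_const_mul]
          ring
  calc _ ≤ ∫ y, B ^ 2 * V * S / t ^ m * ∫ z, (φ y + φ (x - y - z)) ∂ν := by
        refine integral_mono_of_nonneg (.of_forall fun y => by positivity) ?_ (.of_forall hpt)
        exact (integrable_prod_add_comp_sub_sub hφi hφc x).integral_prod_left.const_mul _
    _ = 4 ^ (2 * a) * (2 * K) * (B * V / L ^ a) ^ 2 := by
        have hLa : L ^ (2 * a) = (L ^ a) ^ 2 := by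
          rw [← Real.rpow_natCast, ← Real.rpow_mul hL0.le, Nat.cast_ofNat, mul_comm]
        rw [integral_const_mul, integral_integral_add_comp_sub_sub hφi hφc x, hνV, hφI, hS,
          Real.div_rpow (by norm_num) hL0.le, hLa]
        field_simp
    _ ≤ _ := by
        gcongr
        linarith
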